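/- arXiv:0808.2239 — 4 statements merged into one kernel-verified Lean document; each statement's English description precedes it below -/
import Mathlib

section
/- Let h > 0, let M, Ω ∈ ℝ^{d×d} with Ω symmetric, and set M̃ = M + (hΩ/2)². Then for all q₀, q₁ ∈ ℝ^d, the midpoint discrete Lagrangian with mass matrix M and quadratic potential W(q) = ½qᵀΩ²q equals the trapezoidal discrete Lagrangian with mass matrix M̃ and the same potential; explicitly, (h/2)·((q₁−q₀)/h)ᵀ M ((q₁−q₀)/h) − (h/2)·((q₀+q₁)/2)ᵀ Ω² ((q₀+q₁)/2) = (h/2)·((q₁−q₀)/h)ᵀ M̃ ((q₁−q₀)/h) − (h/2)·(½q₀ᵀΩ²q₀ + ½q₁ᵀΩ²q₁). -/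
open Matrix

/-- The midpoint discrete Lagrangian with mass matrix `M` and quadratic
potential `W q = ½ qᵀ Ω² q` equals the trapezoidal discrete Lagrangian with the
modified mass matrix `M̃ = M + (hΩ/2)²` and the same potential. -/
theorem midpoint_discrete_lagrangian_eq_trapezoidal_with_modified_mass
    {d : ℕ} (h : ℝ) (hh : 0 < h) (M Ω : Matrix (Fin d) (Fin d) ℝ)
    (hΩ : Ω.IsSymm) (Mtilde : Matrix (Fin d) (Fin d) ℝ)
    (hM : Mtilde = M + ((h / 2) • Ω) ^ 2) :
    ∀ q₀ q₁ : Fin d → ℝ,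
      (h / 2) * ((h⁻¹ • (q₁ - q₀)) ⬝ᵥ M.mulVec (h⁻¹ • (q₁ - q₀)))
        - (h / 2) * (((1 / 2 : ℝ) • (q₀ + q₁)) ⬝ᵥ (Ω ^ 2).mulVec ((1 / 2 : ℝ) • (q₀ + q₁)))
      = (h / 2) * ((h⁻¹ • (q₁ - q₀)) ⬝ᵥ Mtilde.mulVec (h⁻¹ • (q₁ - q₀)))
        - (h / 2) * ((1 / 2) * (q₀ ⬝ᵥ (Ω ^ 2).mulVec q₀)
            + (1 / 2) * (q₁ ⬝ᵥ (Ω ^ 2).mulVec q₁)) := by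
  intro q₀ q₁
  subst hM
  simp only [smul_pow, add_mulVec, smul_mulVec, mulVec_smul, mulVec_add, mulVec_sub,
    dotProduct_add, dotProduct_sub, dotProduct_smul, add_dotProduct, sub_dotProduct,
    smul_dotProduct, smul_eq_mul]
  field_simp
  ring
end

section
/- Let h > 0, let Ω ∈ ℝ^{d×d} be symmetric, let U : ℝ^d → ℝ be an arbitrary function, and set M̃ = I + (hΩ/2)². Then for all q₀, q₁ ∈ ℝ^d, the IMEX discrete Lagrangian with mass matrix I, slow potential U, and fast potential W(q) = ½qᵀΩ²q equals the trapezoidal discrete Lagrangian with mass matrix M̃ and total potential U + W; explicitly, (h/2)((q₁−q₀)/h)ᵀ((q₁−q₀)/h) − h(U(q₀)+U(q₁))/2 − (h/2)((q₀+q₁)/2)ᵀΩ²((q₀+q₁)/2) = (h/2)((q₁−q₀)/h)ᵀ M̃ ((q₁−q₀)/h) − h[(U(q₀)+½q₀ᵀΩ²q₀) + (U(q₁)+½q₁ᵀΩ²q₁)]/2. -/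
open Matrix

/-- The IMEX discrete Lagrangian with mass matrix `I`, slow potential `U`,
and quadratic fast potential `W q = ½ qᵀ Ω² q` equals the trapezoidal discrete Lagrangian
with modified mass matrix `M̃ = I + (hΩ/2)²` and total potential `U + W`. -/
theorem imex_discrete_lagrangian_eq_trapezoidal_with_modified_mass
    {d : ℕ} (h : ℝ) (hh : 0 < h) (Ω : Matrix (Fin d) (Fin d) ℝ)
    (hΩ : Ω.IsSymm) (U : (Fin d → ℝ) → ℝ) (Mtilde : Matrix (Fin d) (Fin d) ℝ)
    (hM : Mtilde = 1 + ((h / 2) • Ω) ^ 2) :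
    ∀ q₀ q₁ : Fin d → ℝ,
      (h / 2) * ((h⁻¹ • (q₁ - q₀)) ⬝ᵥ (h⁻¹ • (q₁ - q₀)))
        - h * (U q₀ + U q₁) / 2
        - (h / 2) * (((1 / 2 : ℝ) • (q₀ + q₁)) ⬝ᵥ (Ω ^ 2).mulVec ((1 / 2 : ℝ) • (q₀ + q₁)))
      = (h / 2) * ((h⁻¹ • (q₁ - q₀)) ⬝ᵥ Mtilde.mulVec (h⁻¹ • (q₁ - q₀)))
        - h * ((U q₀ + (1 / 2) * (q₀ ⬝ᵥ (Ω ^ 2).mulVec q₀))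
            + (U q₁ + (1 / 2) * (q₁ ⬝ᵥ (Ω ^ 2).mulVec q₁))) / 2 := by
  intro q₀ q₁
  subst hM
  have hne : h ≠ 0 := hh.ne'
  rw [smul_pow]
  generalize Ω ^ 2 = A
  simp only [Matrix.add_mulVec, Matrix.one_mulVec, Matrix.smul_mulVec, Matrix.mulVec_smul,
    Matrix.mulVec_add, Matrix.mulVec_sub, dotProduct_add, add_dotProduct, dotProduct_sub,
    sub_dotProduct, dotProduct_smul, smul_dotProduct, smul_eq_mul]
  field_simp
  ring
end

section
/- Let 0 < h < 2 and ω ≥ 0. Then every real sequence (q_n) satisfying the variational IMEX recurrence (1 + (hω/2)²)(q_{n+1} − 2q_n + q_{n−1}) + h²(1+ω²)q_n = 0 for all n is bounded. Moreover, if h > 2, then there exists a solution of this recurrence with |q_n| → ∞ as n → ∞. -/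
open Filter

/-- Solutions of `q (n + 2) = t * q (n + 1) - q n` with `|t| < 2` are bounded. -/
lemma exists_abs_le_of_recurrence {t : ℝ} (ht : t ^ 2 < 4) {q : ℕ → ℝ}
    (hq : ∀ n, q (n + 2) = t * q (n + 1) - q n) : ∃ C : ℝ, ∀ n, |q n| ≤ C := by
  have energy : ∀ n, q (n + 1) ^ 2 + q n ^ 2 - t * q (n + 1) * q n
      = q 1 ^ 2 + q 0 ^ 2 - t * q 1 * q 0 := by
    intro n
    induction n with
    | zero => rfl
    | succ n ih =>
      rw [← ih, hq n]
      ring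
  refine ⟨√((q 1 ^ 2 + q 0 ^ 2 - t * q 1 * q 0) / (1 - t ^ 2 / 4)), fun n => ?_⟩
  apply Real.abs_le_sqrt
  rw [le_div_iff₀ (by linarith), ← energy n]
  nlinarith [sq_nonneg (q (n + 1) - t / 2 * q n)]

/-- If `t < -2`, some solution of `q (n + 2) = t * q (n + 1) - q n` tends to infinity in
absolute value. -/
lemma exists_recurrence_tendsto_abs_atTop {t : ℝ} (ht : t < -2) :
    ∃ q : ℕ → ℝ, (∀ n, q (n + 2) = t * q (n + 1) - q n) ∧
      Tendsto (fun n => |q n|) atTop atTop := by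
  have hs : √(t ^ 2 - 4) ^ 2 = t ^ 2 - 4 := Real.sq_sqrt (by nlinarith)
  have hs0 : 0 ≤ √(t ^ 2 - 4) := Real.sqrt_nonneg _
  refine ⟨fun n => ((t - √(t ^ 2 - 4)) / 2) ^ n, fun n => ?_, ?_⟩
  · beta_reduce
    linear_combination (((t - √(t ^ 2 - 4)) / 2) ^ n / 4) * hs
  · simp only [abs_pow]
    apply tendsto_pow_atTop_atTop_of_one_lt
    rw [lt_abs]
    right
    linarith

/-- Dividing by `a`, the recurrence `a * (z - 2 * y + x) + b * y = 0` becomes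
`z = (2 - b / a) * y - x`. -/
lemma recurrence_iff_of_ne_zero {a : ℝ} (ha : a ≠ 0) (b x y z : ℝ) :
    a * (z - 2 * y + x) + b * y = 0 ↔ z = (2 - b / a) * y - x := by
  have key : a * (z - 2 * y + x) + b * y = a * (z - ((2 - b / a) * y - x)) := by
    field_simp
    ring
  rw [key, mul_eq_zero, or_iff_right ha, sub_eq_zero]

/-- For `0 < h < 2` and `ω ≥ 0`, every real sequence satisfying the
variational IMEX recurrence
`(1 + (hω/2)²)(q_{n+1} − 2q_n + q_{n−1}) + h²(1+ω²)q_n = 0` is bounded; moreover,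
if `h > 2` then some solution of this recurrence satisfies `|q_n| → ∞`. -/
theorem imex_recurrence_bounded_iff_stable (h ω : ℝ) (hω : 0 ≤ ω) :
    ((0 < h ∧ h < 2) →
      ∀ q : ℕ → ℝ,
        (∀ n : ℕ,
          (1 + (h * ω / 2) ^ 2) * (q (n + 2) - 2 * q (n + 1) + q n)
            + h ^ 2 * (1 + ω ^ 2) * q (n + 1) = 0) →
        ∃ C : ℝ, ∀ n : ℕ, |q n| ≤ C)
    ∧ (2 < h →
      ∃ q : ℕ → ℝ,
        (∀ n : ℕ,
          (1 + (h * ω / 2) ^ 2) * (q (n + 2) - 2 * q (n + 1) + q n)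
            + h ^ 2 * (1 + ω ^ 2) * q (n + 1) = 0)
        ∧ Tendsto (fun n => |q n|) atTop atTop) := by
  have ha : 0 < 1 + (h * ω / 2) ^ 2 := by positivity
  simp only [recurrence_iff_of_ne_zero ha.ne']
  refine ⟨fun ⟨h0, h2⟩ q hq => exists_abs_le_of_recurrence ?_ hq,
    fun h2 => exists_recurrence_tendsto_abs_atTop ?_⟩
  · have hpos : 0 < h ^ 2 * (1 + ω ^ 2) / (1 + (h * ω / 2) ^ 2) := by positivity
    have hlt : h ^ 2 * (1 + ω ^ 2) / (1 + (h * ω / 2) ^ 2) < 4 := by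
      rw [div_lt_iff₀ ha]
      nlinarith
    nlinarith
  · have hgt : 4 < h ^ 2 * (1 + ω ^ 2) / (1 + (h * ω / 2) ^ 2) := by
      rw [lt_div_iff₀ ha]
      nlinarith
    linarith
end

section
/- Let U : ℝ^d → ℝ be differentiable with slow force g = −∇U, let Ω ∈ ℝ^{d×d} be symmetric, and let h > 0. Then for all q₋, q₀, q₊ ∈ ℝ^d, the discrete Euler–Lagrange equation ∇₁L_h^IMEX(q₀, q₊) + ∇₂L_h^IMEX(q₋, q₀) = 0 for the IMEX discrete Lagrangian with mass matrix I, slow potential U, and fast potential W(q) = ½qᵀΩ²q holds if and only if [I + (h²/4)Ω²](q₊ − 2q₀ + q₋) + h²Ω²q₀ = h²g(q₀); that is, the IMEX scheme coincides with Störmer/Verlet with the modified mass matrix I + (hΩ/2)². -/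
open Matrix RealInnerProductSpace

/-- The IMEX discrete Lagrangian with mass matrix `I`, slow potential `U`, and quadratic
fast potential `W q = ½ qᵀ Ω² q`:
`L_h^IMEX(q₀,q₁) = (h/2)((q₁−q₀)/h)ᵀ((q₁−q₀)/h) − h(U(q₀)+U(q₁))/2
  − (h/2)((q₀+q₁)/2)ᵀΩ²((q₀+q₁)/2)`. -/
noncomputable def imexOscDiscreteLagrangian {d : ℕ} (h : ℝ) (Ω : Matrix (Fin d) (Fin d) ℝ)
    (U : EuclideanSpace ℝ (Fin d) → ℝ) (q₀ q₁ : EuclideanSpace ℝ (Fin d)) : ℝ :=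
  (h / 2) * ⟪h⁻¹ • (q₁ - q₀), h⁻¹ • (q₁ - q₀)⟫
    - h * (U q₀ + U q₁) / 2
    - (h / 2) * ⟪(1 / 2 : ℝ) • (q₀ + q₁),
        Matrix.toEuclideanLin (Ω ^ 2) ((1 / 2 : ℝ) • (q₀ + q₁))⟫

/-- The gradient of a symmetric quadratic form along an affine shift. -/
theorem hasGradientAt_inner_map_self_add {E : Type*} [NormedAddCommGroup E]
    [InnerProductSpace ℝ E] [CompleteSpace E] {T : E →L[ℝ] E} (hT : (T : E →ₗ[ℝ] E).IsSymmetric)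
    (a x : E) :
    HasGradientAt (fun y => ⟪y + a, T (y + a)⟫) ((2 : ℝ) • T (x + a)) x := by
  have hid : HasFDerivAt (fun y : E => y + a) (ContinuousLinearMap.id ℝ E) x :=
    (hasFDerivAt_id x).add_const a
  have hTd : HasFDerivAt (fun y : E => T (y + a)) (T.comp (ContinuousLinearMap.id ℝ E)) x :=
    T.hasFDerivAt.comp x hid
  rw [hasGradientAt_iff_hasFDerivAt]
  refine (hid.inner ℝ hTd).congr_fderiv ?_
  ext v
  have hsymm : ⟪T (x + a), v⟫ = ⟪x + a, T v⟫ := hT (x + a) v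
  have hcomm : ⟪T (x + a), v⟫ = ⟪v, T (x + a)⟫ := real_inner_comm _ _
  simp only [ContinuousLinearMap.comp_apply, ContinuousLinearMap.prod_apply,
    fderivInnerCLM_apply, ContinuousLinearMap.id_apply, InnerProductSpace.toDual_apply_apply,
    real_inner_smul_left]
  linarith

theorem imexOscDiscreteLagrangian_comm {d : ℕ} (h : ℝ) (Ω : Matrix (Fin d) (Fin d) ℝ)
    (U : EuclideanSpace ℝ (Fin d) → ℝ) (q₀ q₁ : EuclideanSpace ℝ (Fin d)) :
    imexOscDiscreteLagrangian h Ω U q₀ q₁ = imexOscDiscreteLagrangian h Ω U q₁ q₀ := by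
  unfold imexOscDiscreteLagrangian
  rw [← neg_sub q₀ q₁, smul_neg, inner_neg_neg, add_comm q₀ q₁, add_comm (U q₀)]

theorem hasGradientAt_imexOscDiscreteLagrangian_left {d : ℕ} {h : ℝ} (hh : h ≠ 0)
    {Ω : Matrix (Fin d) (Fin d) ℝ} (hΩ : Ω.IsSymm) {U : EuclideanSpace ℝ (Fin d) → ℝ}
    {x : EuclideanSpace ℝ (Fin d)} (hU : DifferentiableAt ℝ U x)
    (a : EuclideanSpace ℝ (Fin d)) :
    HasGradientAt (fun y => imexOscDiscreteLagrangian h Ω U y a)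
      (h⁻¹ • (x - a) - (h / 2) • gradient U x
        - (h / 4) • Matrix.toEuclideanLin (Ω ^ 2) (x + a)) x := by
  set T := (Matrix.toEuclideanLin (Ω ^ 2)).toContinuousLinearMap with hTdef
  have hT : (T : EuclideanSpace ℝ (Fin d) →ₗ[ℝ] _).IsSymmetric := by
    have hH : (Ω ^ 2).IsHermitian := by
      rw [Matrix.IsHermitian, Matrix.conjTranspose_eq_transpose_of_trivial]
      exact hΩ.pow 2
    exact Matrix.isSymmetric_toEuclideanLin_iff.mpr hH
  have hkin := hasGradientAt_inner_map_self_add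
    (T := ContinuousLinearMap.id ℝ (EuclideanSpace ℝ (Fin d))) (fun _ _ => rfl) (-a) x
  have hfast := hasGradientAt_inner_map_self_add hT a x
  have hslow := hU.hasGradientAt
  rw [hasGradientAt_iff_hasFDerivAt] at hkin hfast hslow ⊢
  have hsum := ((hkin.const_mul (h⁻¹ / 2)).sub ((hslow.add_const (U a)).const_mul (h / 2))).sub
    (hfast.const_mul (h / 8))
  refine (hsum.congr_fderiv ?_).congr_of_eventuallyEq (.of_forall fun y => ?_)
  · ext v
    simp [hTdef]
    ring
  · simp only [imexOscDiscreteLagrangian, ← neg_sub y a, smul_neg, inner_neg_neg, map_smul,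
      real_inner_smul_left, real_inner_smul_right, Pi.sub_apply, ContinuousLinearMap.id_apply,
      ← sub_eq_add_neg, hTdef, LinearMap.coe_toContinuousLinearMap']
    field_simp
    ring

/-- for the highly oscillatory problem (mass `I`, slow potential `U` with
slow force `g = −∇U`, quadratic fast potential `W q = ½ qᵀ Ω² q`), the discrete
Euler–Lagrange equations of the IMEX discrete Lagrangian hold iff
`[I + (h²/4)Ω²](q₊ − 2q₀ + q₋) + h²Ω²q₀ = h²g(q₀)`, i.e. the IMEX scheme is
Störmer/Verlet with the modified mass matrix `I + (hΩ/2)²`. -/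
theorem imex_osc_discrete_euler_lagrange_iff {d : ℕ} (h : ℝ) (hh : 0 < h)
    (Ω : Matrix (Fin d) (Fin d) ℝ) (hΩ : Ω.IsSymm)
    (U : EuclideanSpace ℝ (Fin d) → ℝ) (hU : Differentiable ℝ U)
    (g : EuclideanSpace ℝ (Fin d) → EuclideanSpace ℝ (Fin d))
    (hg : ∀ q, g q = -gradient U q)
    (qm q0 qp : EuclideanSpace ℝ (Fin d)) :
    (gradient (fun x => imexOscDiscreteLagrangian h Ω U x qp) q0
        + gradient (fun x => imexOscDiscreteLagrangian h Ω U qm x) q0 = 0)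
    ↔ Matrix.toEuclideanLin (1 + (h ^ 2 / 4) • Ω ^ 2) (qp - (2 : ℝ) • q0 + qm)
        + (h ^ 2) • Matrix.toEuclideanLin (Ω ^ 2) q0
        = (h ^ 2) • g q0 := by
  have hleft := (hasGradientAt_imexOscDiscreteLagrangian_left hh.ne' hΩ (hU q0) qp).gradient
  have hright := (hasGradientAt_imexOscDiscreteLagrangian_left hh.ne' hΩ (hU q0) qm).gradient
  simp only [imexOscDiscreteLagrangian_comm h Ω U qm, hleft, hright, hg]
  rw [← sub_eq_zero (b := (h ^ 2) • -gradient U q0),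
    ← smul_eq_zero_iff_right (neg_ne_zero.mpr hh.ne')]
  have hone : Matrix.toEuclideanLin (1 : Matrix (Fin d) (Fin d) ℝ) = LinearMap.id := by
    ext v
    simp
  simp only [map_add, map_sub, map_smul, hone, LinearMap.add_apply, LinearMap.smul_apply,
    LinearMap.id_apply]
  refine Eq.congr_left ?_
  match_scalars <;> field_simp <;> ring
end
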